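/- Let 𝔽_q be a finite field, let e ≥ 1, and let x : Fin K → 𝔽_q be injective with x_i ≠ 0 for all i (pairwise distinct nonzero evaluation points). Let Z ⊆ Fin K with |Z| = e − 1. Then for every fixed secret s ∈ 𝔽_q, the map sending a : Fin (e−1) → 𝔽_q to the share tuple ( s + Σ_{j=1}^{e−1} a_j · (x_i)^j )_{i ∈ Z} ∈ 𝔽_q^Z is a bijection from 𝔽_q^{e−1} onto 𝔽_q^Z. Consequently, for a uniformly random a, the shares observed by any set of e − 1 participants are uniformly distributed on 𝔽_q^Z regardless of the secret s, so a non-qualified set gains no information about the secret. -/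

import Mathlib

/-- The matrix `(v i ^ (j + 1))` of positive powers of pairwise distinct nonzero elements of a
field is invertible. -/
theorem isUnit_of_pow_succ {F : Type*} [Field F] {n : ℕ} {v : Fin n → F}
    (hv : Function.Injective v) (hv0 : ∀ i, v i ≠ 0) :
    IsUnit (Matrix.of fun i j : Fin n => v i ^ ((j : ℕ) + 1)) := by
  have h : (Matrix.of fun i j : Fin n => v i ^ ((j : ℕ) + 1)) =
      Matrix.diagonal v * Matrix.vandermonde v := by
    ext i j
    simp [Matrix.vandermonde_apply, pow_succ']
  rw [h, Matrix.isUnit_iff_isUnit_det, Matrix.det_mul, Matrix.det_diagonal, isUnit_iff_ne_zero]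
  exact mul_ne_zero (Finset.prod_ne_zero_iff.mpr fun i _ => hv0 i)
    (Matrix.det_vandermonde_ne_zero_iff.mpr hv)

/-- Polynomials of degree at most `n` with constant coefficient `s` are determined by, and can
take, arbitrary values at `n` distinct nonzero points. -/
theorem bijective_add_sum_mul_pow_succ {F : Type*} [Field F] {n : ℕ} {v : Fin n → F}
    (hv : Function.Injective v) (hv0 : ∀ i, v i ≠ 0) (s : F) :
    Function.Bijective
      (fun (a : Fin n → F) => fun i => s + ∑ j : Fin n, a j * v i ^ ((j : ℕ) + 1)) := by
  have hM := isUnit_of_pow_succ hv hv0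
  have hbij : Function.Bijective (Matrix.of fun i j : Fin n => v i ^ ((j : ℕ) + 1)).mulVec :=
    ⟨Matrix.mulVec_injective_iff_isUnit.mpr hM, Matrix.mulVec_surjective_iff_isUnit.mpr hM⟩
  convert (Equiv.addLeft (fun _ : Fin n => s)).bijective.comp hbij using 1
  ext a i
  simp [Matrix.mulVec, dotProduct, mul_comm]


/-- Shamir/Smith perfect secrecy: for pairwise distinct nonzero evaluation points and any
set `Z` of exactly `e - 1` participants, for every fixed secret `s` the map
`a ↦ (s + Σ_{j=1}^{e-1} a_j x_i^j)_{i ∈ Z}` is a bijection from `𝔽_q^{e-1}` onto `𝔽_q^Z`;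
hence the shares of a non-qualified set are uniform regardless of the secret. -/
theorem shamir_shares_bijective
    (F : Type*) [Field F]
    (K e : ℕ) (he : 1 ≤ e)
    (x : Fin K → F) (hx : Function.Injective x) (hx0 : ∀ i, x i ≠ 0)
    (Z : Finset (Fin K)) (hZ : Z.card = e - 1) (s : F) :
    Function.Bijective
      (fun (a : Fin (e - 1) → F) =>
        fun i : Z => s + ∑ j : Fin (e - 1), a j * x (i : Fin K) ^ ((j : ℕ) + 1)) := by
  have e₀ : Fin (e - 1) ≃ Z := (Z.equivFinOfCardEq hZ).symm
  have h := bijective_add_sum_mul_pow_succ (v := fun k => x (e₀ k))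
    (hx.comp (Subtype.val_injective.comp e₀.injective)) (fun k => hx0 _) s
  convert (Equiv.arrowCongr e₀ (Equiv.refl F)).bijective.comp h using 1
  ext a i
  simp
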